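/- Let β ∈ (0,1), θ ∈ (-π, π) with θ ≠ 0, and t ∈ ℝ. Then ∫₀^∞ s^{β + it - 1} (e^{iθ} - s)^{-1} ds = (-e^{iθ})^{β + it - 1} · π / sin(π(β + it - 1)), where (-e^{iθ})^{β+it-1} denotes the principal complex power. -/

import Mathlib

open MeasureTheory Set Real

open Filter Topology in
lemma mellinConvergent_inv_one_add {a : ℂ} (h0 : 0 < a.re) (h1 : a.re < 1) :
    MellinConvergent (fun s : ℝ => ((1 : ℂ) + s)⁻¹) a := by
  have hne : ∀ s : ℝ, 0 ≤ s → (1 : ℂ) + s ≠ 0 := fun s hs h => by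
    have := congrArg Complex.re h
    simp at this
    linarith
  have hcont : ContinuousOn (fun s : ℝ => ((1 : ℂ) + s)⁻¹) (Ici 0) :=
    ContinuousOn.inv₀ (by fun_prop) fun s hs => hne s hs
  have hnorm : ∀ s : ℝ, 0 < s → ‖((1 : ℂ) + s)⁻¹‖ = (1 + s)⁻¹ := fun s hs => by
    rw [norm_inv, ← Complex.ofReal_one, ← Complex.ofReal_add, Complex.norm_of_nonneg (by linarith)]
  refine mellinConvergent_of_isBigO_rpow (a := 1) (b := 0)
    ((hcont.mono Ioi_subset_Ici_self).locallyIntegrableOn measurableSet_Ioi) ?_ h1 ?_ h0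
  · refine Asymptotics.IsBigO.of_bound 1 ?_
    filter_upwards [eventually_gt_atTop 0] with s hs
    rw [hnorm s hs, one_mul, Real.rpow_neg_one, Real.norm_of_nonneg (by positivity)]
    gcongr
    linarith
  · refine Asymptotics.IsBigO.of_bound 1 ?_
    filter_upwards [self_mem_nhdsWithin] with s hs
    rw [hnorm s hs]
    simp only [neg_zero, Real.rpow_zero, norm_one, mul_one]
    exact inv_le_one_of_one_le₀ (by linarith [mem_Ioi.1 hs])

lemma image_div_one_sub_Ioo : (fun u : ℝ => u / (1 - u)) '' Ioo 0 1 = Ioi 0 := by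
  ext s
  constructor
  · rintro ⟨u, hu, rfl⟩
    exact div_pos hu.1 (by linarith [hu.2])
  · intro hs
    have hs : 0 < s := hs
    refine ⟨s / (1 + s), ⟨by positivity, (div_lt_one (by positivity)).2 (by linarith)⟩, ?_⟩
    field_simp
    ring

lemma mellin_inv_one_add {a : ℂ} (h0 : 0 < a.re) (h1 : a.re < 1) :
    mellin (fun s : ℝ => ((1 : ℂ) + s)⁻¹) a = π / Complex.sin (π * a) := by
  have hb : Complex.betaIntegral a (1 - a) = π / Complex.sin (π * a) := by
    rw [Complex.betaIntegral_eq_Gamma_mul_div _ _ h0 (by simpa using h1),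
      Complex.Gamma_mul_Gamma_one_sub]
    simp
  rw [← hb, mellin, ← image_div_one_sub_Ioo, Complex.betaIntegral,
    intervalIntegral.integral_of_le zero_le_one, integral_Ioc_eq_integral_Ioo,
    integral_image_eq_integral_abs_deriv_smul (f' := fun u => ((1 - u) ^ 2)⁻¹) measurableSet_Ioo]
  · refine setIntegral_congr_fun measurableSet_Ioo fun u ⟨hu0, hu1⟩ => ?_
    have hv : 0 < 1 - u := by linarith
    have hvc : (1 : ℂ) - u ≠ 0 := by exact_mod_cast hv.ne'
    have hp : ((1 : ℂ) - u) ^ (a - 1) ≠ 0 := by simp [Complex.cpow_eq_zero_iff, hvc]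
    have hdiv : ((u / (1 - u) : ℝ) : ℂ) ^ (a - 1) = (u : ℂ) ^ (a - 1) / (1 - u : ℂ) ^ (a - 1) := by
      rw [Complex.ofReal_div, Complex.div_cpow_ofReal_nonneg hu0.le hv.le]
      push_cast
      rfl
    have hinv : ((1 : ℂ) + ((u / (1 - u) : ℝ) : ℂ))⁻¹ = 1 - u := by
      push_cast
      field_simp
      ring
    have hexp : (1 - u : ℂ) ^ (1 - a - 1) = ((1 - u : ℂ) ^ (a - 1))⁻¹ * (1 - u : ℂ)⁻¹ := by
      rw [← Complex.cpow_neg, ← Complex.cpow_neg_one, ← Complex.cpow_add _ _ hvc]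
      ring_nf
    simp only [smul_eq_mul, hdiv, hinv, hexp, abs_of_pos (inv_pos.2 (pow_pos hv 2)),
      Complex.real_smul]
    push_cast
    field_simp
  · intro u hu
    have hv : 1 - u ≠ 0 := by linarith [hu.2]
    have := ((hasDerivAt_id u).div ((hasDerivAt_id u).const_sub 1) hv)
    refine (this.congr_deriv ?_).hasDerivWithinAt
    simp only [id]
    field_simp
    ring
  · intro u hu v hv h
    have hu' : 1 - u ≠ 0 := by linarith [hu.2]
    have hv' : 1 - v ≠ 0 := by linarith [hv.2]
    simp only at h
    rw [div_eq_div_iff hu' hv'] at h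
    linarith

lemma mellin_inv_ofReal_add {a : ℂ} (h0 : 0 < a.re) (h1 : a.re < 1) {x : ℝ} (hx : 0 < x) :
    mellin (fun s : ℝ => ((x : ℂ) + s)⁻¹) a = (x : ℂ) ^ (a - 1) * (π / Complex.sin (π * a)) := by
  have hxc : (x : ℂ) ≠ 0 := by exact_mod_cast hx.ne'
  have hf : (fun s : ℝ => ((x : ℂ) + s)⁻¹) =
      fun s : ℝ => (x : ℂ)⁻¹ • (fun s : ℝ => ((1 : ℂ) + s)⁻¹) (x⁻¹ * s) := by
    ext s
    simp only [smul_eq_mul, ← mul_inv]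
    push_cast
    congr 1
    field_simp
  have harg : (x : ℂ).arg ≠ π := by simp [Complex.arg_ofReal_of_nonneg hx.le, pi_ne_zero.symm]
  rw [hf, mellin_const_smul,
    mellin_comp_mul_left (fun s : ℝ => ((1 : ℂ) + s)⁻¹) _ (inv_pos.2 hx), mellin_inv_one_add h0 h1,
    smul_eq_mul, smul_eq_mul, ← mul_assoc, Complex.cpow_sub _ _ hxc, Complex.cpow_one,
    Complex.ofReal_inv, Complex.inv_cpow _ _ harg, Complex.cpow_neg, inv_inv]
  ring

/-- Locally uniformly in `z` off the negative real axis, `1 + s` is bounded by a multiple of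
`‖z + s‖`. -/
lemma exists_norm_inv_add_le {z₀ : ℂ} (hz₀ : z₀ ∈ Complex.slitPlane) :
    ∃ δ > 0, ∃ C, ∀ z ∈ Metric.ball z₀ δ, ∀ s : ℝ, 0 < s →
      z + s ≠ 0 ∧ ‖(z + s)⁻¹‖ ≤ C * ‖((1 : ℂ) + s)⁻¹‖ ∧ ‖(z + s)⁻¹‖ ≤ C := by
  obtain ⟨ε, hε, hball⟩ := Metric.isOpen_iff.1 Complex.isOpen_slitPlane z₀ hz₀
  refine ⟨ε / 2, by positivity, 1 + (‖z₀‖ + ε + 1) / (ε / 2) + 1 / (ε / 2), fun z hz s hs => ?_⟩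
  have hlow : ε / 2 ≤ ‖z + s‖ := by
    by_contra! h
    have hmem : -(s : ℂ) ∈ Metric.ball z₀ ε := by
      rw [Metric.mem_ball, dist_eq_norm] at hz ⊢
      calc ‖-(s : ℂ) - z₀‖ = ‖(z - z₀) - (z + s)‖ := by congr 1; ring
        _ ≤ ‖z - z₀‖ + ‖z + s‖ := norm_sub_le _ _
        _ < ε := by linarith
    have := Complex.neg_ofReal_mem_slitPlane.1 (hball hmem)
    linarith
  have hs_le : s ≤ ‖z + s‖ + (‖z₀‖ + ε) := by
    rw [Metric.mem_ball, dist_eq_norm] at hz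
    have : (s : ℂ) = (z + s) - (z - z₀) - z₀ := by ring
    have h2 : ‖(s : ℂ)‖ ≤ ‖z + s‖ + ‖z - z₀‖ + ‖z₀‖ := by
      rw [this]
      exact (norm_sub_le _ _).trans (add_le_add_left ((norm_sub_le _ _).trans (by simp)) _)
    rw [Complex.norm_of_nonneg hs.le] at h2
    linarith
  have hpos : 0 < ‖z + s‖ := by linarith
  have hA : 0 ≤ (‖z₀‖ + ε + 1) / (ε / 2) := by positivity
  have hB : 0 ≤ 1 / (ε / 2) := by positivity
  refine ⟨norm_pos_iff.1 hpos, ?_, ?_⟩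
  · have h1 : ‖((1 : ℂ) + s)⁻¹‖ = (1 + s)⁻¹ := by
      rw [norm_inv, ← Complex.ofReal_one, ← Complex.ofReal_add,
        Complex.norm_of_nonneg (by linarith)]
    rw [h1, norm_inv, ← div_eq_mul_inv, inv_eq_one_div, div_le_div_iff₀ hpos (by linarith)]
    have h3 : (‖z₀‖ + ε + 1) ≤ (‖z₀‖ + ε + 1) / (ε / 2) * ‖z + s‖ := by
      rw [div_mul_eq_mul_div, le_div_iff₀ (by positivity)]
      gcongr
    nlinarith
  · rw [norm_inv, inv_eq_one_div]
    have : 1 / ‖z + s‖ ≤ 1 / (ε / 2) := by gcongr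
    linarith

lemma differentiableOn_mellin_inv_add {a : ℂ} (h0 : 0 < a.re) (h1 : a.re < 1) :
    DifferentiableOn ℂ (fun z : ℂ => mellin (fun s : ℝ => (z + s)⁻¹) a) Complex.slitPlane := by
  intro z₀ hz₀
  obtain ⟨δ, hδ, C, hC⟩ := exists_norm_inv_add_le hz₀
  have hint : IntegrableOn (fun s : ℝ => (s : ℂ) ^ (a - 1) • ((1 : ℂ) + s)⁻¹) (Ioi 0) :=
    mellinConvergent_inv_one_add h0 h1
  have hpow : Measurable fun s : ℝ => (s : ℂ) ^ (a - 1) := by fun_prop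
  have hmeas : ∀ z : ℂ, AEStronglyMeasurable (fun s : ℝ => (s : ℂ) ^ (a - 1) • (z + s)⁻¹)
      (volume.restrict (Ioi 0)) := fun z =>
    (by fun_prop : Measurable fun s : ℝ => (s : ℂ) ^ (a - 1) • (z + s)⁻¹).aestronglyMeasurable
  have hmeas' : AEStronglyMeasurable
      (fun s : ℝ => (s : ℂ) ^ (a - 1) • (-1 / (z₀ + s) ^ 2)) (volume.restrict (Ioi 0)) :=
    (by fun_prop : Measurable
      fun s : ℝ => (s : ℂ) ^ (a - 1) • (-1 / (z₀ + s) ^ 2)).aestronglyMeasurable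
  have hderiv := hasDerivAt_integral_of_dominated_loc_of_deriv_le
    (μ := volume.restrict (Ioi (0 : ℝ))) (F := fun (z : ℂ) (s : ℝ) => (s : ℂ) ^ (a - 1) • (z + s)⁻¹)
    (F' := fun (z : ℂ) (s : ℝ) => (s : ℂ) ^ (a - 1) • (-1 / (z + s) ^ 2))
    (bound := fun s : ℝ => C * C * ‖(s : ℂ) ^ (a - 1) • ((1 : ℂ) + s)⁻¹‖)
    (Metric.ball_mem_nhds z₀ hδ) (Filter.Eventually.of_forall hmeas) ?_ hmeas' ?_
    (hint.norm.const_mul _) ?_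
  · exact hderiv.2.differentiableAt.differentiableWithinAt
  · refine (hint.norm.const_mul C).mono' (hmeas z₀) ?_
    filter_upwards [ae_restrict_mem measurableSet_Ioi] with s hs
    rw [norm_smul, norm_smul, mul_left_comm]
    gcongr
    exact (hC z₀ (Metric.mem_ball_self hδ) s hs).2.1
  · filter_upwards [ae_restrict_mem measurableSet_Ioi] with s hs z hz
    obtain ⟨-, hb, hb'⟩ := hC z hz s hs
    rw [norm_smul, norm_smul, mul_left_comm, neg_div, norm_neg, one_div, ← inv_pow, norm_pow,
      pow_two, mul_assoc]
    have := (norm_nonneg _).trans hb'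
    gcongr
  · filter_upwards [ae_restrict_mem measurableSet_Ioi] with s hs z hz
    exact (((hasDerivAt_id z).add_const (s : ℂ)).fun_inv (hC z hz s hs).1).const_mul _

open Filter Topology in
/-- The Mellin transform of `s ↦ (z + s)⁻¹` for `z` off the negative real axis. -/
theorem mellin_inv_add {a : ℂ} (h0 : 0 < a.re) (h1 : a.re < 1) {z : ℂ}
    (hz : z ∈ Complex.slitPlane) :
    mellin (fun s : ℝ => (z + s)⁻¹) a = z ^ (a - 1) * (π / Complex.sin (π * a)) := by
  have hF := (differentiableOn_mellin_inv_add h0 h1).analyticOnNhd Complex.isOpen_slitPlane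
  have hG : AnalyticOnNhd ℂ (fun z : ℂ => z ^ (a - 1) * (π / Complex.sin (π * a)))
      Complex.slitPlane :=
    DifferentiableOn.analyticOnNhd (fun w hw =>
      ((differentiableAt_id.cpow_const hw).mul_const _).differentiableWithinAt)
      Complex.isOpen_slitPlane
  have htend : Tendsto (fun x : ℝ => (x : ℂ)) (𝓝[>] 1) (𝓝[≠] 1) := by
    refine tendsto_nhdsWithin_iff.2 ⟨?_, ?_⟩
    · exact (Complex.continuous_ofReal.tendsto' 1 1 (by simp)).mono_left nhdsWithin_le_nhds
    · filter_upwards [self_mem_nhdsWithin] with x hx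
      simpa using (mem_Ioi.1 hx).ne'
  have hfreq : ∃ᶠ w : ℂ in 𝓝[≠] 1, mellin (fun s : ℝ => (w + s)⁻¹) a =
      w ^ (a - 1) * (π / Complex.sin (π * a)) := by
    refine htend.frequently (Eventually.frequently ?_)
    filter_upwards [self_mem_nhdsWithin] with x hx
    exact mellin_inv_ofReal_add h0 h1 (zero_lt_one.trans hx)
  exact hF.eqOn_of_preconnected_of_frequently_eq hG
    (Complex.starConvex_one_slitPlane.isPathConnected
      Complex.one_mem_slitPlane).isConnected.isPreconnected
    Complex.one_mem_slitPlane hfreq hz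

/-- For `β ∈ (0,1)`, `θ ∈ (-π,π) \ {0}` and `t ∈ ℝ`,
`∫₀^∞ s^(β+it-1) (e^(iθ) - s)⁻¹ ds = (-e^(iθ))^(β+it-1) · π / sin(π(β+it-1))`,
with the principal complex power. -/
theorem stmt_7 (β : ℝ) (hβ : β ∈ Ioo (0 : ℝ) 1) (θ : ℝ) (hθ : θ ∈ Ioo (-π) π)
    (hθ0 : θ ≠ 0) (t : ℝ) :
    ∫ s in Ioi (0 : ℝ),
        (s : ℂ) ^ ((β : ℂ) + (t : ℂ) * Complex.I - 1) *
          (Complex.exp ((θ : ℂ) * Complex.I) - (s : ℂ))⁻¹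
      = (-Complex.exp ((θ : ℂ) * Complex.I)) ^ ((β : ℂ) + (t : ℂ) * Complex.I - 1) *
          (π : ℂ) / Complex.sin ((π : ℂ) * ((β : ℂ) + (t : ℂ) * Complex.I - 1)) := by
  have hz : -Complex.exp ((θ : ℂ) * Complex.I) ∈ Complex.slitPlane := by
    refine Complex.mem_slitPlane_iff.2 (Or.inr ?_)
    rw [Complex.neg_im, Complex.exp_ofReal_mul_I_im, neg_ne_zero]
    exact (sin_eq_zero_iff_of_lt_of_lt hθ.1 hθ.2).not.2 hθ0
  have hM := mellin_inv_add (a := (β : ℂ) + (t : ℂ) * Complex.I) (by simpa using hβ.1)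
    (by simpa using hβ.2) hz
  have hsin : Complex.sin ((π : ℂ) * ((β : ℂ) + (t : ℂ) * Complex.I - 1)) =
      -Complex.sin ((π : ℂ) * ((β : ℂ) + (t : ℂ) * Complex.I)) := by
    rw [mul_sub, mul_one, Complex.sin_sub_pi]
  rw [hsin, div_neg, mul_div_assoc, ← hM, mellin, ← integral_neg]
  congr 1 with s
  rw [smul_eq_mul, ← mul_neg, ← inv_neg]
  ring_nf
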